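/- arXiv:2208.08257 — 2 statements merged into one kernel-verified Lean document; each statement's English description precedes it below -/
import Mathlib

section
/- Consider a hypergraph that is a disjoint union of finitely many grid gadgets (of arbitrary sizes) and any 2-coloring of its nodes with colors red and blue. For each grid let t_i be the number of nodes of the minority color within that grid, and let t = ∑_i t_i be the total number of minority-colored nodes. Then the total number of cut hyperedges is at least √t. -/
open Finset

theorem single_grid_bound (n : ℕ) (d : Fin n × Fin n → Bool) :
    min ((Finset.univ.filter fun p : Fin n × Fin n => d p = true).card)
        ((Finset.univ.filter fun p : Fin n × Fin n => d p = false).card) ≤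
    ((Finset.univ.filter fun r : Fin n => ∃ j j' : Fin n, d (r, j) ≠ d (r, j')).card
      + (Finset.univ.filter fun s : Fin n => ∃ r r' : Fin n, d (r, s) ≠ d (r', s)).card) ^ 2 := by
  set A := Finset.univ.filter fun r : Fin n => ∃ j j' : Fin n, d (r, j) ≠ d (r, j') with hA
  set B := Finset.univ.filter fun s : Fin n => ∃ r r' : Fin n, d (r, s) ≠ d (r', s) with hB
  have hle : (Finset.univ.filter fun p : Fin n × Fin n => d p = true).card ≤ n * n := by
    refine (Finset.card_le_univ _).trans ?_
    simp
  by_cases h1 : ∀ r, r ∈ A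
  · have : A.card = n := by
      rw [Finset.eq_univ_iff_forall.mpr h1]; simp
    refine (min_le_left _ _).trans (hle.trans ?_)
    rw [this, sq]; exact Nat.mul_le_mul (by omega) (by omega)
  by_cases h2 : ∀ s, s ∈ B
  · have : B.card = n := by
      rw [Finset.eq_univ_iff_forall.mpr h2]; simp
    refine (min_le_left _ _).trans (hle.trans ?_)
    rw [this, sq]; exact Nat.mul_le_mul (by omega) (by omega)
  push Not at h1 h2
  obtain ⟨r0, hr0⟩ := h1
  obtain ⟨s0, hs0⟩ := h2
  have hr : ∀ j, d (r0, j) = d (r0, s0) := by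
    intro j
    by_contra h
    exact hr0 (by simp only [hA, Finset.mem_filter, Finset.mem_univ, true_and]; exact ⟨j, s0, h⟩)
  have hs : ∀ r, d (r, s0) = d (r0, s0) := by
    intro r
    by_contra h
    exact hs0 (by simp only [hB, Finset.mem_filter, Finset.mem_univ, true_and]; exact ⟨r, r0, h⟩)
  have key : ∀ x : Bool, x ≠ d (r0, s0) →
      (Finset.univ.filter fun p : Fin n × Fin n => d p = x).card ≤ (A.card + B.card) ^ 2 := by
    intro x hx
    have hsub : (Finset.univ.filter fun p : Fin n × Fin n => d p = x) ⊆ A ×ˢ B := by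
      rintro ⟨r, s⟩ hp
      simp only [Finset.mem_filter, Finset.mem_univ, true_and] at hp
      simp only [hA, hB, Finset.mem_product, Finset.mem_filter, Finset.mem_univ, true_and]
      refine ⟨⟨s, s0, ?_⟩, ⟨r, r0, ?_⟩⟩
      · rw [hp, hs]; exact hx
      · rw [hp, hr]; exact hx
    have := Finset.card_le_card hsub
    rw [Finset.card_product] at this
    nlinarith
  cases hd : d (r0, s0)
  · exact (min_le_left _ _).trans (key true (by simp [hd]))
  · exact (min_le_right _ _).trans (key false (by simp [hd]))

theorem sum_sq_le_sq {ι : Type*} (s : Finset ι) (k : ι → ℕ) :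
    ∑ i ∈ s, k i ^ 2 ≤ (∑ i ∈ s, k i) ^ 2 := by
  rw [sq (∑ i ∈ s, k i), Finset.sum_mul]
  refine Finset.sum_le_sum fun i hi => ?_
  rw [sq]
  exact Nat.mul_le_mul_left _ (Finset.single_le_sum (f := k) (fun _ _ => Nat.zero_le _) hi)

/-- **Cut bound for a disjoint union of grid gadgets.**  Consider a hypergraph that is a
disjoint union of finitely many grid gadgets (the grid indexed by `i : ι` has size
`ℓ i × ℓ i`) and a red/blue coloring `c` of its nodes.  If `t i` is the number of
minority-colored nodes within grid `i` and `t = ∑ i, t i`, then the total number of cut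
hyperedges (rows and columns containing both colors) is at least `√t`. -/
theorem grids_cut_lower_bound {ι : Type*} [Fintype ι] [DecidableEq ι] (ℓ : ι → ℕ)
    (c : (Σ i : ι, Fin (ℓ i) × Fin (ℓ i)) → Bool) :
    Real.sqrt ((∑ i : ι,
        min ((Finset.univ.filter fun p : Fin (ℓ i) × Fin (ℓ i) => c ⟨i, p⟩ = true).card)
            ((Finset.univ.filter fun p : Fin (ℓ i) × Fin (ℓ i) => c ⟨i, p⟩ = false).card) : ℕ)) ≤
    ((∑ i : ι,
        ((Finset.univ.filter fun r : Fin (ℓ i) =>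
            ∃ j j' : Fin (ℓ i), c ⟨i, (r, j)⟩ ≠ c ⟨i, (r, j')⟩).card
          + (Finset.univ.filter fun s : Fin (ℓ i) =>
            ∃ r r' : Fin (ℓ i), c ⟨i, (r, s)⟩ ≠ c ⟨i, (r', s)⟩).card) : ℕ) : ℝ) := by
  apply Real.sqrt_le_iff.mpr
  refine ⟨Nat.cast_nonneg _, ?_⟩
  have h := (Finset.sum_le_sum fun i (_ : i ∈ (Finset.univ : Finset ι)) =>
    single_grid_bound (ℓ i) (fun p => c ⟨i, p⟩)).trans (sum_sq_le_sq _ _)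
  exact_mod_cast h
end

section
/- Fix a real ε > 0. There is a constant C = C(ε) such that for all integers s ≥ 0 and 0 ≤ h ≤ s, there exist natural numbers r and b with m := r + b + s ≤ C·(s+1) such that for every integer x with 0 ≤ x ≤ s: the two inequalities r + x ≤ (1+ε)·m/2 and b + (s − x) ≤ (1+ε)·m/2 both hold if and only if x ≤ h. Moreover, for ε = 0 there exist natural numbers r and b with m := r + b + s even such that for every integer 0 ≤ x ≤ s: the two inequalities r + x ≤ m/2 and b + (s − x) ≤ m/2 both hold if and only if x = h. -/
/-- **Arithmetic content of the balance-constraint gadget lemma.**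
(The paper's standing assumption `ε < k - 1 = 1` for `k = 2` is included.)
For `ε > 0` there is a constant `C = C(ε)` such that for all `h ≤ s` one can choose
numbers `r` of fixed red and `b` of fixed blue nodes with `m = r + b + s ≤ C·(s+1)` so
that, for every number `x ≤ s` of red nodes of `S`, the two balance inequalities
`r + x ≤ (1+ε)·m/2` and `b + (s-x) ≤ (1+ε)·m/2` hold iff `x ≤ h`.
For `ε = 0` one can choose `r` and `b` with `m = r + b + s` even so that the two
inequalities `r + x ≤ m/2` and `b + (s-x) ≤ m/2` hold iff `x = h`. -/
theorem enforce_gadget (ε : ℝ) (hε : 0 < ε) (hε1 : ε < 1) :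
    (∃ C : ℝ, ∀ s h : ℕ, h ≤ s → ∃ r b : ℕ,
      ((r + b + s : ℕ) : ℝ) ≤ C * (s + 1) ∧
      ∀ x : ℕ, x ≤ s →
        ((((r + x : ℕ) : ℝ) ≤ (1 + ε) * ((r + b + s : ℕ) : ℝ) / 2 ∧
          ((b + (s - x) : ℕ) : ℝ) ≤ (1 + ε) * ((r + b + s : ℕ) : ℝ) / 2) ↔ x ≤ h)) ∧
    (∀ s h : ℕ, h ≤ s → ∃ r b : ℕ, 2 ∣ (r + b + s) ∧
      ∀ x : ℕ, x ≤ s →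
        ((((r + x : ℕ) : ℝ) ≤ ((r + b + s : ℕ) : ℝ) / 2 ∧
          ((b + (s - x) : ℕ) : ℝ) ≤ ((r + b + s : ℕ) : ℝ) / 2) ↔ x = h)) := by
  constructor
  · have hδ : 0 < 1 - ε := by linarith
    refine ⟨2 / ε + 2 / (1 - ε) + 1, ?_⟩
    intro s h hs
    have hs0 : (0 : ℝ) ≤ s := Nat.cast_nonneg s
    obtain ⟨M, hM1, hM2⟩ : ∃ M : ℕ, (2 / ε + 2 / (1 - ε)) * ((s : ℝ) + 1) ≤ M ∧
        (M : ℝ) < (2 / ε + 2 / (1 - ε)) * ((s : ℝ) + 1) + 1 :=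
      ⟨_, Nat.le_ceil _, Nat.ceil_lt_add_one (by positivity)⟩
    have e1 : 2 * ((s : ℝ) + 1) ≤ ε * M := by
      have h1 : 2 / ε * ((s : ℝ) + 1) ≤ M := by
        have : 0 ≤ 2 / (1 - ε) * ((s : ℝ) + 1) := by positivity
        linarith
      calc 2 * ((s : ℝ) + 1) = ε * (2 / ε * ((s : ℝ) + 1)) := by field_simp
        _ ≤ _ := by gcongr
    have e2 : 2 * ((s : ℝ) + 1) ≤ (1 - ε) * M := by
      have h1 : 2 / (1 - ε) * ((s : ℝ) + 1) ≤ M := by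
        have : 0 ≤ 2 / ε * ((s : ℝ) + 1) := by positivity
        linarith
      calc 2 * ((s : ℝ) + 1) = (1 - ε) * (2 / (1 - ε) * ((s : ℝ) + 1)) := by field_simp
        _ ≤ _ := by gcongr
    obtain ⟨F, hF⟩ : ∃ F : ℕ, F = ⌊(1 + ε) * (M : ℝ) / 2⌋₊ := ⟨_, rfl⟩
    have key : ∀ n : ℕ, (n : ℝ) ≤ (1 + ε) * (M : ℝ) / 2 ↔ n ≤ F := by
      intro n
      rw [hF, Nat.le_floor_iff (by positivity)]
    have f1 : (F : ℝ) ≤ (1 + ε) * (M : ℝ) / 2 := (key F).2 le_rfl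
    have f2 : (1 + ε) * (M : ℝ) / 2 < F + 1 := by
      rw [hF]; exact Nat.lt_floor_add_one _
    have g1 : F + s ≤ M := by
      have : (F : ℝ) + s ≤ M := by linarith
      exact_mod_cast this
    have g2 : M + s ≤ 2 * F := by
      have : (M : ℝ) + s ≤ 2 * F := by linarith
      exact_mod_cast this
    have hm : (F - h) + (M - s - (F - h)) + s = M := by omega
    refine ⟨F - h, M - s - (F - h), ?_, ?_⟩
    · rw [hm]; linarith
    · intro x hx
      rw [hm, key, key]
      omega
  · intro s h hs
    refine ⟨s - h, h, by omega, ?_⟩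
    intro x hx
    have hm : s - h + h + s = 2 * s := by omega
    have key : ∀ n : ℕ, (n : ℝ) ≤ ((2 * s : ℕ) : ℝ) / 2 ↔ n ≤ s := by
      intro n
      have : ((2 * s : ℕ) : ℝ) / 2 = s := by push_cast; ring
      rw [this, Nat.cast_le]
    rw [hm, key, key]
    omega
end
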